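/- arXiv:2010.02291 — 5 statements merged into one kernel-verified Lean document; each statement's English description precedes it below -/
import Mathlib

section
/- Let E be a real inner product space, let I and J be finite index sets, and let f_i : E → ℝ (i ∈ I) and g_j : E → ℝ (j ∈ J) be convex functions differentiable at a point a ∈ E. Let l_i ≥ 0 and m_j ≥ 0 be multipliers satisfying complementarity (l_i ≠ 0 implies f_i(a) = 0, and m_j ≠ 0 implies g_j(a) = 0), and suppose α := Σ_{i∈I} l_i ∇f_i(a) satisfies α = −Σ_{j∈J} m_j ∇g_j(a) and α ≠ 0. Then the sets F = {x : f_i(x) ≤ 0 for all i} and G = {y : g_j(y) ≤ 0 for all j} have disjoint topological interiors; i.e., the objects do not interpenetrate. -/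
theorem grad_ineq_aux {E : Type*} [NormedAddCommGroup E] [InnerProductSpace ℝ E] [CompleteSpace E]
    (f : E → ℝ) (f' a x : E) (hc : ConvexOn ℝ Set.univ f) (hf : HasGradientAt f f' a) :
    inner ℝ f' (x - a) ≤ f x - f a := by
  have hc2 : ConvexOn ℝ Set.univ (fun t : ℝ => f (AffineMap.lineMap a x t)) := by
    exact hc.comp_affineMap (AffineMap.lineMap (k := ℝ) a x)
  have hd : HasDerivAt (fun t : ℝ => f (AffineMap.lineMap a x t)) (inner ℝ f' (x - a)) 0 := by
    have h1 : HasDerivAt (fun t : ℝ => AffineMap.lineMap (k := ℝ) a x t) (x - a) 0 :=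
      AffineMap.hasDerivAt_lineMap
    have h2 : HasFDerivAt f (InnerProductSpace.toDual ℝ E f')
        (AffineMap.lineMap (k := ℝ) a x (0 : ℝ)) := by
      simpa using hf.hasFDerivAt
    have h3 := h2.comp_hasDerivAt (0 : ℝ) h1
    rw [InnerProductSpace.toDual_apply_apply] at h3
    exact h3
  have := hc2.le_slope_of_hasDerivAt (Set.mem_univ 0) (Set.mem_univ 1) one_pos hd
  simpa [slope_def_field] using this

theorem sum_ineq_aux {E : Type*} [NormedAddCommGroup E] [InnerProductSpace ℝ E] [CompleteSpace E]
    {I : Type*} [Fintype I] (f : I → E → ℝ) (f' : I → E) (a x : E)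
    (hc : ∀ i, ConvexOn ℝ Set.univ (f i)) (hf : ∀ i, HasGradientAt (f i) (f' i) a)
    (l : I → ℝ) (hl : ∀ i, 0 ≤ l i) (hlc : ∀ i, l i ≠ 0 → f i a = 0)
    (hx : ∀ i, f i x ≤ 0) : inner ℝ (∑ i, l i • f' i) (x - a) ≤ 0 := by
  rw [sum_inner]
  refine Finset.sum_nonpos fun i _ => ?_
  rw [real_inner_smul_left]
  by_cases h : l i = 0
  · simp [h]
  · have := grad_ineq_aux (f i) (f' i) a x (hc i) (hf i)
    have h2 := hlc i h
    exact mul_nonpos_of_nonneg_of_nonpos (hl i) (by linarith [hx i])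

/-- Non-penetration guarantee. If the KKT-type contact constraints hold at
a touching point `a` with a nonzero combined gradient `α`, then the interiors of the
two convex objects `F = {x | ∀ i, f i x ≤ 0}` and `G = {y | ∀ j, g j y ≤ 0}` are
disjoint. -/
theorem no_interpenetration_of_kkt
    {E : Type*} [NormedAddCommGroup E] [InnerProductSpace ℝ E] [CompleteSpace E]
    {I J : Type*} [Fintype I] [Fintype J]
    (f : I → E → ℝ) (g : J → E → ℝ) (f' : I → E) (g' : J → E) (a : E)
    (hfconv : ∀ i, ConvexOn ℝ Set.univ (f i))
    (hgconv : ∀ j, ConvexOn ℝ Set.univ (g j))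
    (hf' : ∀ i, HasGradientAt (f i) (f' i) a)
    (hg' : ∀ j, HasGradientAt (g j) (g' j) a)
    (l : I → ℝ) (m : J → ℝ) (hl : ∀ i, 0 ≤ l i) (hm : ∀ j, 0 ≤ m j)
    (hlc : ∀ i, l i ≠ 0 → f i a = 0) (hmc : ∀ j, m j ≠ 0 → g j a = 0)
    (α : E) (hα : α = ∑ i, l i • f' i)
    (hopp : α = -∑ j, m j • g' j) (hα0 : α ≠ 0) :
    interior {x : E | ∀ i, f i x ≤ 0} ∩ interior {y : E | ∀ j, g j y ≤ 0} = ∅ := by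
  rw [Set.eq_empty_iff_forall_notMem]
  rintro x ⟨hx, hy⟩
  have hev : ∀ᶠ t : ℝ in nhds 0, x + t • α ∈ interior {x : E | ∀ i, f i x ≤ 0} := by
    have hcont : ContinuousAt (fun t : ℝ => x + t • α) 0 := by fun_prop
    exact hcont.eventually_mem (isOpen_interior.mem_nhds (by simpa using hx))
  obtain ⟨t, ht, ht0⟩ := ((hev.filter_mono nhdsWithin_le_nhds).and
    (self_mem_nhdsWithin : Set.Ioi (0 : ℝ) ∈ nhdsWithin 0 (Set.Ioi 0))).exists
  have h1 := sum_ineq_aux f f' a _ hfconv hf' l hl hlc (interior_subset ht)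
  have h2 := sum_ineq_aux g g' a _ hgconv hg' m hm hmc (interior_subset hy)
  rw [← hα] at h1
  have h3 : ∑ j, m j • g' j = -α := by rw [hopp, neg_neg]
  rw [h3, inner_neg_left] at h2
  rw [add_sub_right_comm, inner_add_right, real_inner_smul_right] at h1
  have h4 : 0 < inner ℝ α α := real_inner_self_pos.mpr hα0
  have h5 := mul_pos (Set.mem_Ioi.mp ht0) h4
  linarith
end

section
/- Let b and n be vectors in ℝ³ (with the standard dot product and cross product) such that b · n ≠ 0. Then for every B ∈ ℝ³ and every d ∈ ℝ there exists a unique pair (r, p) ∈ ℝ³ × ℝ satisfying the two equations r × b + p • n = B and n · r = d. -/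
open Matrix

/-- If `b ⬝ᵥ n ≠ 0`, then for every `B : ℝ³` and `d : ℝ` there is a unique
pair `(r, p)` with `r × b + p • n = B` and `n ⬝ᵥ r = d`. -/
theorem ecp_unique_of_dot_ne_zero
    (b n : Fin 3 → ℝ) (hbn : b ⬝ᵥ n ≠ 0) (B : Fin 3 → ℝ) (d : ℝ) :
    ∃! rp : (Fin 3 → ℝ) × ℝ,
      crossProduct rp.1 b + rp.2 • n = B ∧ n ⬝ᵥ rp.1 = d := by
  obtain ⟨k, hk⟩ : ∃ k : ℝ, k * (b 0 * n 0 + b 1 * n 1 + b 2 * n 2) = 1 := by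
    refine ⟨(b ⬝ᵥ n)⁻¹, ?_⟩
    have h : b ⬝ᵥ n = b 0 * n 0 + b 1 * n 1 + b 2 * n 2 := by
      simp [dotProduct, Fin.sum_univ_three]
    rw [← h]
    exact inv_mul_cancel₀ hbn
  refine ⟨(k • (crossProduct n B + d • b), k * (B ⬝ᵥ b)), ⟨?_, ?_⟩, ?_⟩
  · ext i
    fin_cases i <;> simp [cross_apply, vecHead, vecTail, dotProduct, Fin.sum_univ_three]
    · linear_combination B 0 * hk
    · linear_combination B 1 * hk
    · linear_combination B 2 * hk
  · simp [cross_apply, vecHead, vecTail, dotProduct, Fin.sum_univ_three]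
    linear_combination d * hk
  · rintro ⟨r, p⟩ ⟨h1, h2⟩
    dsimp only at h1 h2
    subst h1 h2
    refine Prod.ext ?_ ?_
    · ext i
      fin_cases i <;> simp [cross_apply, vecHead, vecTail, dotProduct, Fin.sum_univ_three]
      · linear_combination -r 0 * hk
      · linear_combination -r 1 * hk
      · linear_combination -r 2 * hk
    · simp [cross_apply, vecHead, vecTail, dotProduct, Fin.sum_univ_three]
      linear_combination -p * hk
end

section
/- Let b and n be vectors in ℝ³ (with the standard dot product and cross product). The linear map L : ℝ³ × ℝ → ℝ³ × ℝ defined by L(r, p) = (r × b + p • n, n · r) is bijective if and only if b · n ≠ 0. -/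
open Matrix

/-- The linear map `L (r, p) = (r × b + p • n, n ⬝ᵥ r)` on `ℝ³ × ℝ` is
bijective if and only if `b ⬝ᵥ n ≠ 0`. -/
theorem ecp_map_bijective_iff (b n : Fin 3 → ℝ) :
    Function.Bijective
      (fun rp : (Fin 3 → ℝ) × ℝ => (crossProduct rp.1 b + rp.2 • n, n ⬝ᵥ rp.1)) ↔
      b ⬝ᵥ n ≠ 0 := by
  have key : ∀ (r : Fin 3 → ℝ) (p : ℝ) (c : Fin 3 → ℝ) (d : ℝ),
      ((crossProduct r b + p • n, n ⬝ᵥ r) = (c, d)) ↔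
      ((r 1 * b 2 - r 2 * b 1 + p * n 0 = c 0 ∧ r 2 * b 0 - r 0 * b 2 + p * n 1 = c 1 ∧
        r 0 * b 1 - r 1 * b 0 + p * n 2 = c 2) ∧ n 0 * r 0 + n 1 * r 1 + n 2 * r 2 = d) := by
    intro r p c d
    rw [Prod.mk.injEq, funext_iff, Fin.forall_fin_succ, Fin.forall_fin_succ, Fin.forall_fin_succ]
    simp [cross_apply, dotProduct, Fin.sum_univ_three]
  have hbn : b ⬝ᵥ n = b 0 * n 0 + b 1 * n 1 + b 2 * n 2 := by
    simp [dotProduct, Fin.sum_univ_three]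
  rw [hbn]
  constructor
  · rintro ⟨-, hs⟩ h0
    obtain ⟨⟨r, p⟩, h⟩ := hs (b, 0)
    obtain ⟨⟨h1, h2, h3⟩, -⟩ := (key _ _ _ _).1 h
    have hb : b 0 ^ 2 + b 1 ^ 2 + b 2 ^ 2 = 0 := by
      linear_combination (-b 0) * h1 - b 1 * h2 - b 2 * h3 + p * h0
    have b0 : b 0 = 0 := by nlinarith [sq_nonneg (b 0), sq_nonneg (b 1), sq_nonneg (b 2)]
    have b1 : b 1 = 0 := by nlinarith [sq_nonneg (b 0), sq_nonneg (b 1), sq_nonneg (b 2)]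
    have b2 : b 2 = 0 := by nlinarith [sq_nonneg (b 0), sq_nonneg (b 1), sq_nonneg (b 2)]
    obtain ⟨⟨r, p⟩, h⟩ := hs (![1, 0, 0], 0)
    obtain ⟨⟨h1, h2, -⟩, -⟩ := (key _ _ _ _).1 h
    obtain ⟨⟨s, q⟩, h'⟩ := hs (![0, 1, 0], 0)
    obtain ⟨⟨-, h5, -⟩, -⟩ := (key _ _ _ _).1 h'
    simp [b0, b1, b2] at h1 h2 h5
    rcases h2 with h2 | h2 <;> simp [h2] at h1 h5
  · intro h0
    constructor
    · rintro ⟨r, p⟩ ⟨s, q⟩ h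
      have h := (key _ _ _ _).1 h
      simp [cross_apply, dotProduct, Fin.sum_univ_three] at h
      obtain ⟨⟨h1, h2, h3⟩, h4⟩ := h
      have hp : p = q := by
        apply mul_right_cancel₀ h0
        linear_combination b 0 * h1 + b 1 * h2 + b 2 * h3
      subst hp
      rw [Prod.mk.injEq]
      refine ⟨?_, rfl⟩
      ext i
      apply mul_right_cancel₀ h0
      fin_cases i
      · simp [-mul_eq_mul_right_iff]; linear_combination n 1 * h3 - n 2 * h2 + b 0 * h4
      · simp [-mul_eq_mul_right_iff]; linear_combination n 2 * h1 - n 0 * h3 + b 1 * h4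
      · simp [-mul_eq_mul_right_iff]; linear_combination n 0 * h2 - n 1 * h1 + b 2 * h4
    · rintro ⟨c, d⟩
      set D := b 0 * n 0 + b 1 * n 1 + b 2 * n 2 with hD
      refine ⟨(![(n 1 * c 2 - n 2 * c 1 + d * b 0) / D, (n 2 * c 0 - n 0 * c 2 + d * b 1) / D,
        (n 0 * c 1 - n 1 * c 0 + d * b 2) / D], (c 0 * b 0 + c 1 * b 1 + c 2 * b 2) / D), ?_⟩
      refine (key _ _ _ _).2 ?_
      simp
      refine ⟨⟨?_, ?_, ?_⟩, ?_⟩ <;> field_simp <;> rw [hD] <;> ring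
end

section
/- Let n, t, o be an orthonormal basis of ℝ³ (with the standard dot product and cross product), let c ∈ ℝ³ satisfy n · c ≠ 0, and let B ∈ ℝ³ and d ∈ ℝ. Then there exists a unique tuple (p_n, p_t, p_o, p_r, r) ∈ ℝ × ℝ × ℝ × ℝ × ℝ³ satisfying the three equations: (i) p_n • n + p_t • t + p_o • o = c; (ii) p_n • (r × n) + p_t • (r × t) + p_o • (r × o) + p_r • n = B; (iii) n · r = d. -/
open Matrix


theorem ecp_aux_complete (n t o : Fin 3 → ℝ)
    (hnn : n ⬝ᵥ n = 1) (htt : t ⬝ᵥ t = 1) (hoo : o ⬝ᵥ o = 1)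
    (hnt : n ⬝ᵥ t = 0) (hno : n ⬝ᵥ o = 0) (hto : t ⬝ᵥ o = 0) (c : Fin 3 → ℝ) :
    (n ⬝ᵥ c) • n + (t ⬝ᵥ c) • t + (o ⬝ᵥ c) • o = c := by
  have h : (Matrix.of ![n, t, o]) * (Matrix.of ![n, t, o])ᵀ = 1 := by
    ext i j
    have e : ((Matrix.of ![n, t, o]) * (Matrix.of ![n, t, o])ᵀ) i j
        = (![n, t, o] i) ⬝ᵥ (![n, t, o] j) := rfl
    rw [e]
    fin_cases i <;> fin_cases j <;>
      simp [hnn, htt, hoo, hnt, hno, hto, dotProduct_comm t n, dotProduct_comm o n,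
        dotProduct_comm o t]
  have h2 := mul_eq_one_comm.mp h
  have h3 : ((Matrix.of ![n, t, o])ᵀ * (Matrix.of ![n, t, o])) *ᵥ c = c := by
    rw [h2, one_mulVec]
  rw [← mulVec_mulVec] at h3
  conv_rhs => rw [← h3]
  ext i
  simp [mulVec, dotProduct, Fin.sum_univ_three]
  ring

/-- Well-posedness of the ECP and contact wrench computation. For an
orthonormal basis `n, t, o` of `ℝ³` and `c` with `n ⬝ᵥ c ≠ 0`, the system consisting of
the linear momentum balance, the angular momentum balance, and the supporting-hyperplane
equation has a unique solution `(p_n, p_t, p_o, p_r, r)`. -/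
theorem ecp_wrench_unique
    (n t o : Fin 3 → ℝ)
    (hnn : n ⬝ᵥ n = 1) (htt : t ⬝ᵥ t = 1) (hoo : o ⬝ᵥ o = 1)
    (hnt : n ⬝ᵥ t = 0) (hno : n ⬝ᵥ o = 0) (hto : t ⬝ᵥ o = 0)
    (c : Fin 3 → ℝ) (hc : n ⬝ᵥ c ≠ 0) (B : Fin 3 → ℝ) (d : ℝ) :
    ∃! s : ℝ × ℝ × ℝ × ℝ × (Fin 3 → ℝ),
      s.1 • n + s.2.1 • t + s.2.2.1 • o = c ∧
      s.1 • crossProduct s.2.2.2.2 n + s.2.1 • crossProduct s.2.2.2.2 t +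
        s.2.2.1 • crossProduct s.2.2.2.2 o + s.2.2.2.1 • n = B ∧
      n ⬝ᵥ s.2.2.2.2 = d := by
  have key : ∀ (a b e : ℝ) (r : Fin 3 → ℝ), a • n + b • t + e • o = c →
      a • crossProduct r n + b • crossProduct r t + e • crossProduct r o
        = crossProduct r c := by
    intro a b e r h
    rw [← h]
    simp
  refine ⟨(n ⬝ᵥ c, t ⬝ᵥ c, o ⬝ᵥ c, (B ⬝ᵥ c) / (n ⬝ᵥ c),
    (n ⬝ᵥ c)⁻¹ • (crossProduct n B + d • c)), ?_, ?_⟩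
  · have h1 := ecp_aux_complete n t o hnn htt hoo hnt hno hto c
    refine ⟨h1, ?_, ?_⟩
    · dsimp only
      rw [key _ _ _ _ h1]
      have h4 : crossProduct (crossProduct n B) c = (n ⬝ᵥ c) • B - (B ⬝ᵥ c) • n := by
        ext i
        fin_cases i <;> simp [cross_apply, dotProduct, Fin.sum_univ_three] <;> ring
      simp only [map_smul, map_add, LinearMap.smul_apply, LinearMap.add_apply, h4, cross_self]
      ext i
      simp
      field_simp
      ring
    · dsimp only
      rw [dotProduct_smul, dotProduct_add, dot_self_cross, dotProduct_smul]
      simp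
      field_simp
  · rintro ⟨a, b, e, p, r⟩ ⟨h1, h2, h3⟩
    dsimp only at h1 h2 h3
    rw [key _ _ _ _ h1] at h2
    have ha : a = n ⬝ᵥ c := by
      rw [← h1]; simp [dotProduct_add, hnn, hnt, hno]
    have hb : b = t ⬝ᵥ c := by
      rw [← h1]; simp [dotProduct_add, htt, hto, dotProduct_comm t n, hnt]
    have he : e = o ⬝ᵥ c := by
      rw [← h1]; simp [dotProduct_add, hoo, dotProduct_comm o n, dotProduct_comm o t, hno, hto]
    have hp : p = (B ⬝ᵥ c) / (n ⬝ᵥ c) := by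
      rw [eq_div_iff hc, ← h2, add_dotProduct, smul_dotProduct,
        dotProduct_comm (crossProduct r c) c, dot_cross_self]
      simp
    have hr : r = (n ⬝ᵥ c)⁻¹ • (crossProduct n B + d • c) := by
      rw [eq_inv_smul_iff₀ hc, ← h2, ← h3, map_add, map_smul, cross_self, smul_zero, add_zero]
      ext i
      fin_cases i <;> simp [cross_apply, dotProduct, Fin.sum_univ_three] <;> ring
    rw [← ha, ← hb, ← he] at *
    simp only [Prod.mk.injEq, true_and]
    exact ⟨hp, hr⟩
end

section
/- Let e_t, e_o, e_r > 0, μ > 0, λ_n > 0 and v_t, v_o, v_r ∈ ℝ, and set s = √(e_t² v_t² + e_o² v_o² + e_r² v_r²); assume s > 0. Suppose (λ_t, λ_o, λ_r, σ) ∈ ℝ⁴ with σ > 0 satisfies the Fritz–John system: e_t² μ λ_n v_t + λ_t σ = 0, e_o² μ λ_n v_o + λ_o σ = 0, e_r² μ λ_n v_r + λ_r σ = 0, together with the active-constraint (complementarity) condition μ² λ_n² − ((λ_t/e_t)² + (λ_o/e_o)² + (λ_r/e_r)²) = 0. Then σ = s and λ_t = −μ λ_n e_t² v_t / s, λ_o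 = −μ λ_n e_o² v_o / s, λ_r = −μ λ_n e_r² v_r / s; i.e., the solution of the Fritz–John system with positive multiplier is unique and equals the maximizer of the power dissipation over the friction ellipsoid. -/
/-- Uniqueness of the Fritz–John point with positive multiplier. If
`(λt, λo, λr, σ)` with `σ > 0` satisfies the Fritz–John system together with the active
friction-ellipsoid constraint, then `σ = s` and `(λt, λo, λr)` equals the maximizer of
the power dissipation. -/
theorem fritz_john_unique
    (et eo er : ℝ) (het : 0 < et) (heo : 0 < eo) (her : 0 < er)
    (μ : ℝ) (hμ : 0 < μ) (lamn : ℝ) (hlamn : 0 < lamn)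
    (vt vo vr : ℝ)
    (s : ℝ) (hs : s = Real.sqrt (et ^ 2 * vt ^ 2 + eo ^ 2 * vo ^ 2 + er ^ 2 * vr ^ 2))
    (hspos : 0 < s)
    (lamt lamo lamr σ : ℝ) (hσ : 0 < σ)
    (h1 : et ^ 2 * μ * lamn * vt + lamt * σ = 0)
    (h2 : eo ^ 2 * μ * lamn * vo + lamo * σ = 0)
    (h3 : er ^ 2 * μ * lamn * vr + lamr * σ = 0)
    (h4 : μ ^ 2 * lamn ^ 2 -
        ((lamt / et) ^ 2 + (lamo / eo) ^ 2 + (lamr / er) ^ 2) = 0) :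
    σ = s ∧ lamt = -(μ * lamn * et ^ 2 * vt / s) ∧
      lamo = -(μ * lamn * eo ^ 2 * vo / s) ∧
      lamr = -(μ * lamn * er ^ 2 * vr / s) := by
  have key : ∀ e v l : ℝ, 0 < e → e ^ 2 * μ * lamn * v + l * σ = 0 →
      (l / e) ^ 2 * σ ^ 2 = (μ * lamn) ^ 2 * (e ^ 2 * v ^ 2) := by
    intro e v l he h
    have h' : l / e * σ = -(μ * lamn * (e * v)) := by
      field_simp
      linarith
    rw [← mul_pow, h']
    ring
  have hs2 : s ^ 2 = et ^ 2 * vt ^ 2 + eo ^ 2 * vo ^ 2 + er ^ 2 * vr ^ 2 := by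
    rw [hs]
    exact Real.sq_sqrt (by positivity)
  have k1 := key et vt lamt het h1
  have k2 := key eo vo lamo heo h2
  have k3 := key er vr lamr her h3
  have hm : (μ * lamn) ^ 2 ≠ 0 := by positivity
  have hsq : σ ^ 2 = s ^ 2 := by
    apply mul_left_cancel₀ hm
    rw [hs2]
    linear_combination σ ^ 2 * h4 + k1 + k2 + k3
  have hσs : σ = s := (pow_left_inj₀ hσ.le hspos.le two_ne_zero).mp hsq
  have fin : ∀ e v l : ℝ, e ^ 2 * μ * lamn * v + l * σ = 0 →
      l = -(μ * lamn * e ^ 2 * v / s) := by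
    intro e v l h
    rw [hσs] at h
    field_simp
    linarith
  exact ⟨hσs, fin _ _ _ h1, fin _ _ _ h2, fin _ _ _ h3⟩
end
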